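/- Let F be a finite field with #F ≥ 32, and let q_1 = Y_0Y_1 + s_1(Y_1,Y_2,Y_3) and q_2 = Y_0Y_2 + s_2(Y_1,Y_2,Y_3) be quadratic forms in the four variables Y_0,Y_1,Y_2,Y_3 over F, where s_1, s_2 are ternary quadratic forms. Suppose s_1(0,0,1) and s_2(0,0,1) are not both zero. Then either q_1 and q_2 have a singular common zero over F (a nonzero y in F^4 with q_1(y) = q_2(y) = 0 and ∇q_1(y), ∇q_2(y) proportional), or there are at least 5(#F - 1) nonzero pairs (a,b) in F² for which a q_1 + b q_2 is a sum of two hyperbolic planes, i.e. equivalent over F to Y_0Y_1 + Y_2Y_3. -/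

import Mathlib

open MvPolynomial NumberField IsDedekindDomain

/-- Substitution `q(T·X)` for a matrix `T`. -/
noncomputable def substMat {K : Type*} [CommRing K] {n : ℕ}
    (T : Matrix (Fin n) (Fin n) K) (q : MvPolynomial (Fin n) K) : MvPolynomial (Fin n) K :=
  MvPolynomial.aeval (fun i => ∑ j, MvPolynomial.C (T i j) * MvPolynomial.X j) q

/-- `q` is a function of the variables `X_0, …, X_{m-1}` alone. -/
def DependsOnlyOnFirst {K : Type*} [CommRing K] {n : ℕ} (m : ℕ)
    (q : MvPolynomial (Fin n) K) : Prop :=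
  ∀ i ∈ q.vars, (i : ℕ) < m

/-- The rank of a quadratic form: the least `m` such that an invertible linear change of
variables makes it a function of the first `m` variables alone. -/
noncomputable def qRank {K : Type*} [Field K] {n : ℕ} (q : MvPolynomial (Fin n) K) : ℕ :=
  sInf {m | ∃ T : Matrix (Fin n) (Fin n) K, IsUnit T.det ∧ DependsOnlyOnFirst m (substMat T q)}

/-- The polynomial `X_0X_1 + X_2X_3 + ⋯ + X_{2m-2}X_{2m-1}` (a sum of `m` hyperbolic planes). -/
noncomputable def hypSum (n m : ℕ) (K : Type*) [CommRing K] : MvPolynomial (Fin n) K :=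
  ∑ i ∈ Finset.range m,
    if h : 2 * i + 1 < n then
      MvPolynomial.X (⟨2 * i, by omega⟩ : Fin n) * MvPolynomial.X (⟨2 * i + 1, h⟩ : Fin n)
    else 0

/-- A quadratic form in `n` variables splits off (at least) `m` hyperbolic planes: an invertible
change of variables puts it in the shape `X_0X_1 + ⋯ + X_{2m-2}X_{2m-1} + Q'(X_{2m},…,X_{n-1})`. -/
def SplitsOffHyperbolics {K : Type*} [Field K] {n : ℕ} (m : ℕ)
    (Q : MvPolynomial (Fin n) K) : Prop :=
  2 * m ≤ n ∧ ∃ T : Matrix (Fin n) (Fin n) K, IsUnit T.det ∧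
    ∃ Q' : MvPolynomial (Fin n) K, (∀ i ∈ Q'.vars, 2 * m ≤ (i : ℕ)) ∧
      substMat T Q = hypSum n m K + Q'

/-- The intersection of the two quadrics `Q₁ = Q₂ = 0` is nonsingular: the `2 × n` matrix of
partial derivatives has rank `2` at every nonzero point over the algebraic closure. -/
def NonsingularIntersection {K : Type*} [Field K] {n : ℕ}
    (Q₁ Q₂ : MvPolynomial (Fin n) K) : Prop :=
  ∀ x : Fin n → AlgebraicClosure K, x ≠ 0 →
    Matrix.rank (Matrix.of fun (i : Fin 2) (j : Fin n) =>
      MvPolynomial.eval x (MvPolynomial.pderiv j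
        (MvPolynomial.map (algebraMap K (AlgebraicClosure K)) (if i = 0 then Q₁ else Q₂)))) = 2

/-- `r(q₁,q₂)`: the maximal rank of a nontrivial form in the pencil, over the algebraic
closure. -/
noncomputable def pencilRmax {K : Type*} [Field K] {n : ℕ}
    (q₁ q₂ : MvPolynomial (Fin n) K) : ℕ :=
  sSup {m | ∃ a b : AlgebraicClosure K, (a ≠ 0 ∨ b ≠ 0) ∧
    m = qRank (MvPolynomial.C a * MvPolynomial.map (algebraMap K (AlgebraicClosure K)) q₁ +
      MvPolynomial.C b * MvPolynomial.map (algebraMap K (AlgebraicClosure K)) q₂)}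

/-- `r_min(q₁,q₂)`: the minimal rank of a nontrivial form in the pencil, over the algebraic
closure. -/
noncomputable def pencilRmin {K : Type*} [Field K] {n : ℕ}
    (q₁ q₂ : MvPolynomial (Fin n) K) : ℕ :=
  sInf {m | ∃ a b : AlgebraicClosure K, (a ≠ 0 ∨ b ≠ 0) ∧
    m = qRank (MvPolynomial.C a * MvPolynomial.map (algebraMap K (AlgebraicClosure K)) q₁ +
      MvPolynomial.C b * MvPolynomial.map (algebraMap K (AlgebraicClosure K)) q₂)}

/-- `R(q₁,q₂)`: the least `m` such that an invertible change of variables over `K` makes every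
form in the pencil (over the algebraic closure) a function of the first `m` variables alone. -/
noncomputable def pencilR {K : Type*} [Field K] {n : ℕ}
    (q₁ q₂ : MvPolynomial (Fin n) K) : ℕ :=
  sInf {m | ∃ T : Matrix (Fin n) (Fin n) K, IsUnit T.det ∧
    ∀ a b : AlgebraicClosure K,
      DependsOnlyOnFirst m
        (MvPolynomial.C a * MvPolynomial.map (algebraMap K (AlgebraicClosure K)) (substMat T q₁) +
         MvPolynomial.C b * MvPolynomial.map (algebraMap K (AlgebraicClosure K)) (substMat T q₂))}

/-- The symmetrized coefficient matrix `M(q)` of a quadratic form `q = ∑_{i ≤ j} q_{ij}X_iX_j`: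
its `(i,j)` entry is `q_{ij}` for `i < j`, `2q_{ii}` for `i = j`, and `q_{ji}` for `i > j`. -/
noncomputable def Mmat {K : Type*} [CommRing K] {n : ℕ}
    (q : MvPolynomial (Fin n) K) : Matrix (Fin n) (Fin n) K :=
  Matrix.of fun i j =>
    if i < j then q.coeff (Finsupp.single i 1 + Finsupp.single j 1)
    else if i = j then 2 * q.coeff (Finsupp.single i 2)
    else q.coeff (Finsupp.single j 1 + Finsupp.single i 1)


section ResidueAlgebra

variable {F : Type*} [Field F]

/-- Trace and norm are preserved by the Frobenius of a quadratic algebra over a finite field. -/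
theorem QuadraticAlgebra.omega_pow_card [Fintype F] (a b : F) :
    2 * ((omega : QuadraticAlgebra F (-a) (-b)) ^ Fintype.card F).re
        - b * ((omega : QuadraticAlgebra F (-a) (-b)) ^ Fintype.card F).im = -b ∧
      norm ((omega : QuadraticAlgebra F (-a) (-b)) ^ Fintype.card F) = a := by
  constructor
  · have h1 : (omega : QuadraticAlgebra F (-a) (-b)) + star omega
        = algebraMap F _ (-b) := by
      ext <;> simp
    have h2 := congrArg (FiniteField.frobeniusAlgHom F _) h1
    rw [map_add, AlgHom.commutes] at h2
    simp only [FiniteField.coe_frobeniusAlgHom] at h2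
    rw [← star_pow] at h2
    have h3 := congrArg QuadraticAlgebra.re h2
    simp only [re_add, re_star, algebraMap_re] at h3
    linear_combination h3
  · rw [map_pow, norm_def]
    simp [FiniteField.pow_card]

theorem QuadraticAlgebra.frobenius_omega [Fintype F] {a b : F} (hd : b ^ 2 - 4 * a ≠ 0) :
    (omega : QuadraticAlgebra F (-a) (-b)) ^ Fintype.card F = omega ∨
      (omega : QuadraticAlgebra F (-a) (-b)) ^ Fintype.card F = star omega := by
  obtain ⟨ht, hn⟩ := omega_pow_card a b
  generalize (omega : QuadraticAlgebra F (-a) (-b)) ^ Fintype.card F = V at *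
  obtain ⟨x, y⟩ := V
  rw [norm_def] at hn
  simp only at ht hn
  have hy : (y - 1) * (y + 1) = 0 := by
    have : (b ^ 2 - 4 * a) * ((y - 1) * (y + 1)) = 0 := by
      linear_combination (2 * x - b * y - b) * ht - 4 * hn
    exact (mul_eq_zero.mp this).resolve_left hd
  have h2 : (2 : F) = 0 ∨ (2 : F) ≠ 0 := em _
  rcases mul_eq_zero.mp hy with hy | hy
  · have hy : y = 1 := by linear_combination hy
    subst hy
    have hx : x * (x - b) = 0 := by linear_combination hn
    have hx2 : 2 * x = 0 := by linear_combination ht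
    rcases h2 with h2 | h2
    · rcases mul_eq_zero.mp hx with hx | hx
      · left; ext <;> simp [hx]
      · right; ext
        · simp; linear_combination hx + b * h2
        · simp; linear_combination h2
    · left; ext
      · simpa [h2] using hx2
      · simp
  · have hy : y = -1 := by linear_combination hy
    subst hy
    have hx : x * (x + b) = 0 := by linear_combination hn
    have hx2 : 2 * (x + b) = 0 := by linear_combination ht
    rcases h2 with h2 | h2
    · rcases mul_eq_zero.mp hx with hx | hx
      · left; ext
        · simp [hx]
        · simp; linear_combination -h2
      · right; ext
        · simp; linear_combination hx
        · simp
    · right; ext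
      · have := (mul_eq_zero.mp hx2).resolve_left h2
        simp; linear_combination this
      · simp

theorem QuadraticAlgebra.exists_roots_of_frobenius_omega [Fintype F] {a b : F}
    (hd : b ^ 2 - 4 * a ≠ 0)
    (h : (omega : QuadraticAlgebra F (-a) (-b)) ^ Fintype.card F = omega) :
    ∃ r s : F, r ≠ s ∧ r + s = -b ∧ r * s = a := by
  classical
  have hprod : ∏ c : F, (Polynomial.X - Polynomial.C c)
      = (Polynomial.X ^ Fintype.card F - Polynomial.X : Polynomial F) := by
    have hm : (Polynomial.X ^ Fintype.card F - Polynomial.X : Polynomial F).Monic :=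
      Polynomial.monic_X_pow_sub (by simpa using Fintype.one_lt_card)
    have hr := FiniteField.roots_X_pow_card_sub_X F
    rw [← Polynomial.prod_multiset_X_sub_C_of_monic_of_roots_card_eq hm, hr]
    · rfl
    · rw [hr, FiniteField.X_pow_card_sub_X_natDegree_eq F Fintype.one_lt_card]
      simp
  have h0 := congrArg (Polynomial.aeval (omega : QuadraticAlgebra F (-a) (-b))) hprod
  simp only [map_prod, map_sub, map_pow, Polynomial.aeval_X, Polynomial.aeval_C, h, sub_self] at h0
  have h1 := congrArg norm h0
  rw [map_prod, norm_zero, Finset.prod_eq_zero_iff] at h1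
  obtain ⟨r, -, hr⟩ := h1
  simp [norm_def] at hr
  refine ⟨r, -b - r, fun hrs => hd ?_, by ring, by linear_combination -hr⟩
  have hrs' : 2 * r + b = 0 := by linear_combination hrs
  linear_combination (-4) * hr + (2 * r + b) * hrs'

theorem QuadraticAlgebra.sub_star_mul_frobenius_sub_star [Fintype F] {a b : F}
    (hd : b ^ 2 - 4 * a = 0) :
    ((omega : QuadraticAlgebra F (-a) (-b)) - star omega) *
      (omega ^ Fintype.card F - star omega) = 0 := by
  obtain ⟨ht, hn⟩ := omega_pow_card a b
  generalize (omega : QuadraticAlgebra F (-a) (-b)) ^ Fintype.card F = V at *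
  obtain ⟨x, y⟩ := V
  rw [norm_def] at hn
  simp only at ht hn
  have hre : b * (x + b) - 2 * a * (y + 1) = 0 := by
    by_cases h2 : (2 : F) = 0
    · have hb : b = 0 := by
        have : b ^ 2 = 0 := by linear_combination hd + 2 * a * h2
        exact pow_eq_zero_iff two_ne_zero |>.mp this
      rw [hb]; linear_combination (-a * (y + 1)) * h2
    · refine (mul_eq_zero.mp (?_ : (2 : F) * _ = 0)).resolve_left h2
      linear_combination b * ht + (y + 1) * hd
  ext
  · simp; linear_combination hre
  · simp; linear_combination ht

end ResidueAlgebra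

/-- Coefficients of the affine curve `v² + (b₀ + b₁t + b₂t²)v + (a₀ + a₁t + a₂t² + a₃t³) = 0`,
a double cover of the `t`-line. -/
structure DoubleCover (F : Type*) where
  (b₀ b₁ b₂ a₀ a₁ a₂ a₃ : F)

namespace DoubleCover

section Identities

variable {F R S : Type*} [CommRing F] [CommRing R] [Algebra F R] [CommRing S] [Algebra F S]
  (m : DoubleCover F)

/-- The coefficient of `v`. -/
def B (t : R) : R :=
  algebraMap F R m.b₀ + algebraMap F R m.b₁ * t + algebraMap F R m.b₂ * t ^ 2

/-- The constant coefficient. -/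
def A (t : R) : R :=
  algebraMap F R m.a₀ + algebraMap F R m.a₁ * t + algebraMap F R m.a₂ * t ^ 2 +
    algebraMap F R m.a₃ * t ^ 3

/-- The derivative of `B`. -/
def dB (t : R) : R := algebraMap F R m.b₁ + 2 * algebraMap F R m.b₂ * t

/-- The derivative of `A`. -/
def dA (t : R) : R :=
  algebraMap F R m.a₁ + 2 * algebraMap F R m.a₂ * t + 3 * algebraMap F R m.a₃ * t ^ 2

/-- The discriminant of the cover. -/
def disc (t : R) : R := m.B t ^ 2 - 4 * m.A t

theorem map_B (f : R →ₐ[F] S) (t : R) : f (m.B t) = m.B (f t) := by simp [B]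

theorem map_A (f : R →ₐ[F] S) (t : R) : f (m.A t) = m.A (f t) := by simp [A]

theorem map_dB (f : R →ₐ[F] S) (t : R) : f (m.dB t) = m.dB (f t) := by simp [dB, map_ofNat]

theorem map_dA (f : R →ₐ[F] S) (t : R) : f (m.dA t) = m.dA (f t) := by simp [dA, map_ofNat]

theorem map_disc (f : R →ₐ[F] S) (t : R) : f (m.disc t) = m.disc (f t) := by
  simp [disc, map_B, map_A, map_ofNat]

/-- For points `(t, v)`, `(T, V)` of the curve, and `w` conjugate to `v`, this vanishes to second
order along `(T, V) = (t, w)`. -/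
def tangentNum (t v w T V : R) : R :=
  (v - w) * (V - w + algebraMap F R m.b₂ * (T - t) ^ 2) - (w * m.dB t + m.dA t) * (T - t)

variable {m}

theorem sq_dvd_tangentNum {x t v w T V : R} (hv : v + w = -m.B t)
    (hw : w ^ 2 + m.B t * w + m.A t = 0)
    (hV : V ^ 2 + m.B T * V + m.A T = 0) (hT : x ∣ T - t) (hVw : x ∣ V - w) :
    x ^ 2 ∣ m.tangentNum t v w T V := by
  obtain ⟨k, hk⟩ := hT
  obtain ⟨z, hz⟩ := hVw
  obtain rfl : T = t + x * k := by linear_combination hk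
  obtain rfl : V = w + x * z := by linear_combination hz
  obtain rfl : v = -m.B t - w := by linear_combination hv
  refine ⟨z ^ 2 + z * k * (algebraMap F R m.b₁ + algebraMap F R m.b₂ * (2 * t + x * k)) +
    w * algebraMap F R m.b₂ * k ^ 2 +
    (algebraMap F R m.a₂ + algebraMap F R m.a₃ * (3 * t + x * k)) * k ^ 2 +
    (-m.B t - 2 * w) * algebraMap F R m.b₂ * k ^ 2, ?_⟩
  simp only [tangentNum, B, A, dB, dA] at *
  linear_combination hw - hV

theorem tangentNum_sub_swap {t v w T V W : R} (hv : v + w = -m.B t) (hV : V + W = -m.B T) :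
    m.tangentNum t v w T V - m.tangentNum t w v T W =
      algebraMap F R m.b₂ * (v - w) * (T - t) ^ 2 := by
  obtain rfl : v = -m.B t - w := by linear_combination hv
  obtain rfl : W = -m.B T - V := by linear_combination hV
  simp only [tangentNum, B, dB, dA]
  ring

end Identities

end DoubleCover

section CoordinateRing

open QuadraticAlgebra

variable {R : Type*} [CommRing R]

/-- The weight filtration on a quadratic algebra over `R[X]`, with `X` of weight one and `ω` of
weight two. -/
def QuadraticAlgebra.WeightLE {a b : Polynomial R} (n : ℕ)
    (z : QuadraticAlgebra (Polynomial R) a b) : Prop :=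
  z.re.natDegree ≤ n ∧ (Polynomial.X ^ 2 * z.im).natDegree ≤ n

namespace QuadraticAlgebra.WeightLE

variable {a b : Polynomial R} {k n : ℕ} {x y z : QuadraticAlgebra (Polynomial R) a b}

theorem mono (h : z.WeightLE n) (hk : n ≤ k) : z.WeightLE k := ⟨h.1.trans hk, h.2.trans hk⟩

theorem add (hx : x.WeightLE n) (hy : y.WeightLE n) : (x + y).WeightLE n := by
  refine ⟨Polynomial.natDegree_add_le_of_degree_le hx.1 hy.1, ?_⟩
  rw [im_add, mul_add]
  exact Polynomial.natDegree_add_le_of_degree_le hx.2 hy.2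

theorem neg (hx : x.WeightLE n) : (-x).WeightLE n := by
  simpa [WeightLE] using hx

theorem sub (hx : x.WeightLE n) (hy : y.WeightLE n) : (x - y).WeightLE n := by
  rw [sub_eq_add_neg]
  exact hx.add hy.neg

theorem of_base {p : Polynomial R} (hp : p.natDegree ≤ n) :
    (algebraMap _ (QuadraticAlgebra (Polynomial R) a b) p).WeightLE n := by
  simpa [WeightLE] using hp

theorem of_omega : (ω : QuadraticAlgebra (Polynomial R) a b).WeightLE 2 := by
  simpa [WeightLE] using Polynomial.natDegree_X_pow_le (R := R) 2

variable [IsDomain R]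

theorem im_eq (hz : z.WeightLE n) : z.im = 0 ∨ z.im.natDegree + 2 ≤ n := by
  refine or_iff_not_imp_left.mpr fun h0 => ?_
  have := hz.2
  rwa [Polynomial.natDegree_mul (pow_ne_zero _ Polynomial.X_ne_zero) h0,
    Polynomial.natDegree_X_pow, add_comm] at this

theorem mul (ha : a.natDegree ≤ 4) (hb : b.natDegree ≤ 2) (hx : x.WeightLE k)
    (hy : y.WeightLE n) : (x * y).WeightLE (k + n) := by
  have key : ∀ c : Polynomial R, ∀ d, c.natDegree ≤ d → d ≤ 4 →
      (c * x.im * y.im).natDegree + (4 - d) ≤ k + n ∨ c * x.im * y.im = 0 := by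
    intro c d hc hd
    rcases hx.im_eq with h | h
    · simp [h]
    rcases hy.im_eq with h' | h'
    · simp [h']
    left
    have h1 := Polynomial.natDegree_mul_le (p := c * x.im) (q := y.im)
    have h2 := Polynomial.natDegree_mul_le (p := c) (q := x.im)
    omega
  constructor
  · rw [re_mul]
    refine Polynomial.natDegree_add_le_of_degree_le
      (Polynomial.natDegree_mul_le.trans (add_le_add hx.1 hy.1)) ?_
    rcases key a 4 ha le_rfl with h | h
    · simpa using h
    · simp [h]
  · rw [im_mul, mul_add, mul_add]
    refine Polynomial.natDegree_add_le_of_degree_le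
      (Polynomial.natDegree_add_le_of_degree_le ?_ ?_) ?_
    · rw [mul_left_comm]
      exact Polynomial.natDegree_mul_le.trans (add_le_add hx.1 hy.2)
    · rw [← mul_assoc]
      exact Polynomial.natDegree_mul_le.trans (add_le_add hx.2 hy.1)
    · rcases key b 2 hb (by norm_num) with h | h
      · have h1 := Polynomial.natDegree_mul_le (p := Polynomial.X ^ 2) (q := b * x.im * y.im)
        rw [Polynomial.natDegree_X_pow] at h1
        omega
      · simp [h]

theorem pow (ha : a.natDegree ≤ 4) (hb : b.natDegree ≤ 2) (hx : x.WeightLE k) (n : ℕ) :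
    (x ^ n).WeightLE (n * k) := by
  induction n with
  | zero => simp [WeightLE]
  | succ n ih =>
    rw [pow_succ, Nat.succ_mul]
    exact ih.mul ha hb hx

theorem trace_le (hb : b.natDegree ≤ 2) (hz : z.WeightLE n) : (trace z).natDegree ≤ n := by
  rw [trace_def]
  refine Polynomial.natDegree_add_le_of_degree_le ?_ ?_
  · refine Polynomial.natDegree_mul_le.trans ?_
    simpa using hz.1
  · rcases hz.im_eq with h | h
    · simp [h]
    · exact Polynomial.natDegree_mul_le.trans (by omega)

theorem conj (hb : b.natDegree ≤ 2) (hz : z.WeightLE n) : (star z).WeightLE n := by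
  have : Star.star z = algebraMap _ _ (trace z) - z := by
    rw [algebraMap_trace_eq_add_star]; ring
  rw [this]
  exact (WeightLE.of_base (hz.trace_le hb)).sub hz

theorem norm_le (ha : a.natDegree ≤ 4) (hb : b.natDegree ≤ 2) (hz : z.WeightLE n) :
    (norm z).natDegree ≤ n + n := by
  have h := (hz.mul ha hb (hz.conj hb)).1
  rwa [← algebraMap_norm_eq_mul_star, algebraMap_re] at h

end QuadraticAlgebra.WeightLE

end CoordinateRing

namespace DoubleCover

open QuadraticAlgebra

theorem tangentNum_mul_swap {F R : Type*} [CommRing F] [CommRing R] [Algebra F R]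
    {m : DoubleCover F} {t v w T V W : R} (hv : v + w = -m.B t) (hvw : v * w = m.A t)
    (hV : V + W = -m.B T) (hVW : V * W = m.A T) :
    m.tangentNum t v w T V * m.tangentNum t w v T W =
      -(m.disc t * (m.A T - algebraMap F R m.b₂ * (T - t) ^ 2 *
          (m.B T - algebraMap F R m.b₂ * (T - t) ^ 2))) -
        ((v - w) * (V + algebraMap F R m.b₂ * (T - t) ^ 2) *
            ((w - v) * v + (v * m.dB t + m.dA t) * (T - t)) +
          (w - v) * (W + algebraMap F R m.b₂ * (T - t) ^ 2) *
            ((v - w) * w + (w * m.dB t + m.dA t) * (T - t))) +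
        ((v - w) * w + (w * m.dB t + m.dA t) * (T - t)) *
          ((w - v) * v + (v * m.dB t + m.dA t) * (T - t)) := by
  rw [disc, ← hvw, ← hVW, ← neg_eq_iff_eq_neg.mpr hv, ← neg_eq_iff_eq_neg.mpr hV]
  simp only [tangentNum]
  ring

section Frobenius

variable {F : Type*} [Field F] (m : DoubleCover F)

/-- The affine coordinate ring of the double cover. -/
abbrev CoordRing : Type _ :=
  QuadraticAlgebra (Polynomial F) (-m.A Polynomial.X) (-m.B Polynomial.X)

/-- The coordinate function `t`. -/
noncomputable def t : m.CoordRing := algebraMap (Polynomial F) _ Polynomial.X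

theorem algebraMap_A (p : Polynomial F) :
    algebraMap (Polynomial F) m.CoordRing (m.A p) = m.A (algebraMap (Polynomial F) m.CoordRing p) :=
  m.map_A (IsScalarTower.toAlgHom F (Polynomial F) m.CoordRing) p

theorem algebraMap_B (p : Polynomial F) :
    algebraMap (Polynomial F) m.CoordRing (m.B p) = m.B (algebraMap (Polynomial F) m.CoordRing p) :=
  m.map_B (IsScalarTower.toAlgHom F (Polynomial F) m.CoordRing) p

theorem algebraMap_dA (p : Polynomial F) :
    algebraMap (Polynomial F) m.CoordRing (m.dA p) =
      m.dA (algebraMap (Polynomial F) m.CoordRing p) :=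
  m.map_dA (IsScalarTower.toAlgHom F (Polynomial F) m.CoordRing) p

theorem algebraMap_dB (p : Polynomial F) :
    algebraMap (Polynomial F) m.CoordRing (m.dB p) =
      m.dB (algebraMap (Polynomial F) m.CoordRing p) :=
  m.map_dB (IsScalarTower.toAlgHom F (Polynomial F) m.CoordRing) p

theorem algebraMap_disc (p : Polynomial F) :
    algebraMap (Polynomial F) m.CoordRing (m.disc p) =
      m.disc (algebraMap (Polynomial F) m.CoordRing p) :=
  m.map_disc (IsScalarTower.toAlgHom F (Polynomial F) m.CoordRing) p

theorem omega_add_star : (ω : m.CoordRing) + star ω = -m.B m.t := by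
  rw [t, ← algebraMap_B]
  ext <;> simp

theorem omega_mul_star : (ω : m.CoordRing) * star ω = m.A m.t := by
  rw [t, ← algebraMap_A]
  ext <;> simp

theorem star_t : star m.t = m.t := by
  rw [t]; ext <;> simp

theorem star_algebraMap {p : Polynomial F} : star (algebraMap (Polynomial F) m.CoordRing p) =
    algebraMap (Polynomial F) m.CoordRing p := by
  ext <;> simp

variable [Fintype F]

theorem B_pow {R : Type*} [CommRing R] [Algebra F R] (t : R) :
    m.B t ^ Fintype.card F = m.B (t ^ Fintype.card F) :=
  m.map_B (FiniteField.frobeniusAlgHom F R) t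

theorem A_pow {R : Type*} [CommRing R] [Algebra F R] (t : R) :
    m.A t ^ Fintype.card F = m.A (t ^ Fintype.card F) :=
  m.map_A (FiniteField.frobeniusAlgHom F R) t

theorem neg_B_pow {R : Type*} [CommRing R] [Algebra F R] (t : R) :
    (-m.B t) ^ Fintype.card F = -m.B (t ^ Fintype.card F) := by
  have := (FiniteField.frobeniusAlgHom F R).map_neg (m.B t)
  simpa [FiniteField.coe_frobeniusAlgHom, B_pow] using this

theorem omega_pow_add_star :
    (ω : m.CoordRing) ^ Fintype.card F + star (ω ^ Fintype.card F) =
      -m.B (m.t ^ Fintype.card F) := by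
  have := _root_.map_add (FiniteField.frobeniusAlgHom F m.CoordRing) ω (star ω)
  simp only [FiniteField.coe_frobeniusAlgHom, omega_add_star, neg_B_pow] at this
  rw [this, star_pow]

theorem omega_pow_mul_star :
    (ω : m.CoordRing) ^ Fintype.card F * star (ω ^ Fintype.card F) =
      m.A (m.t ^ Fintype.card F) := by
  rw [star_pow, ← mul_pow, omega_mul_star, A_pow]

/-- The function on the double cover which measures the failure of the Frobenius to agree with
the involution to second order. -/
noncomputable def frobTangent : m.CoordRing :=
  m.tangentNum m.t ω (star ω) (m.t ^ Fintype.card F) (ω ^ Fintype.card F)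

theorem star_frobTangent :
    star m.frobTangent =
      m.tangentNum m.t (star ω) ω (m.t ^ Fintype.card F) (star (ω ^ Fintype.card F)) := by
  have hb : star (algebraMap F m.CoordRing m.b₂) = algebraMap F m.CoordRing m.b₂ :=
    m.star_algebraMap (p := Polynomial.C m.b₂)
  have hdB : star (m.dB m.t) = m.dB m.t := by
    rw [t, ← algebraMap_dB, star_algebraMap]
  have hdA : star (m.dA m.t) = m.dA m.t := by
    rw [t, ← algebraMap_dA, star_algebraMap]
  simp only [frobTangent, tangentNum, star_sub, star_add, star_mul', star_pow, star_star, star_t,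
    hb, hdB, hdA]

theorem norm_frobTangent :
    QuadraticAlgebra.norm m.frobTangent =
      -(m.disc Polynomial.X * (m.A (Polynomial.X ^ Fintype.card F) -
          Polynomial.C m.b₂ * (Polynomial.X ^ Fintype.card F - Polynomial.X) ^ 2 *
            (m.B (Polynomial.X ^ Fintype.card F) -
              Polynomial.C m.b₂ * (Polynomial.X ^ Fintype.card F - Polynomial.X) ^ 2))) -
        trace ((ω - star ω) * (ω ^ Fintype.card F +
              algebraMap F m.CoordRing m.b₂ * (m.t ^ Fintype.card F - m.t) ^ 2) *
            ((star ω - ω) * ω + (ω * m.dB m.t + m.dA m.t) * (m.t ^ Fintype.card F - m.t))) +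
        QuadraticAlgebra.norm ((ω - star ω) * star ω +
          (star ω * m.dB m.t + m.dA m.t) * (m.t ^ Fintype.card F - m.t)) := by
  have hb : star (algebraMap F m.CoordRing m.b₂) = algebraMap F m.CoordRing m.b₂ :=
    m.star_algebraMap (p := Polynomial.C m.b₂)
  have hdB : star (m.dB m.t) = m.dB m.t := by
    rw [t, ← algebraMap_dB, star_algebraMap]
  have hdA : star (m.dA m.t) = m.dA m.t := by
    rw [t, ← algebraMap_dA, star_algebraMap]
  have hC : algebraMap (Polynomial F) m.CoordRing (Polynomial.C m.b₂) = algebraMap F _ m.b₂ := rfl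
  have ht : algebraMap (Polynomial F) m.CoordRing Polynomial.X = m.t := rfl
  apply algebraMap_injective (R := Polynomial F) (a := -m.A Polynomial.X) (b := -m.B Polynomial.X)
  rw [algebraMap_norm_eq_mul_star, star_frobTangent, frobTangent,
    tangentNum_mul_swap m.omega_add_star m.omega_mul_star m.omega_pow_add_star m.omega_pow_mul_star]
  simp only [map_add, map_sub, map_neg, map_mul, map_pow, algebraMap_norm_eq_mul_star,
    algebraMap_trace_eq_add_star, algebraMap_disc, algebraMap_A, algebraMap_B,
    star_sub, star_add, star_mul', star_pow, star_star, star_t, hb, hdB, hdA, hC, ht]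

end Frobenius

section Degree

variable {F : Type*} [Field F] (m : DoubleCover F)

theorem natDegree_B_le (p : Polynomial F) : (m.B p).natDegree ≤ 2 * p.natDegree := by
  have h2 := Polynomial.natDegree_pow_le (p := p) (n := 2)
  refine Polynomial.natDegree_add_le_of_degree_le
    (Polynomial.natDegree_add_le_of_degree_le ?_ ?_) ?_
  · exact (Polynomial.natDegree_C _).trans_le (Nat.zero_le _)
  · exact (Polynomial.natDegree_C_mul_le _ _).trans (by omega)
  · exact (Polynomial.natDegree_C_mul_le _ _).trans h2

theorem natDegree_A_le (p : Polynomial F) : (m.A p).natDegree ≤ 3 * p.natDegree := by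
  have h2 := Polynomial.natDegree_pow_le (p := p) (n := 2)
  have h3 := Polynomial.natDegree_pow_le (p := p) (n := 3)
  refine Polynomial.natDegree_add_le_of_degree_le (Polynomial.natDegree_add_le_of_degree_le
    (Polynomial.natDegree_add_le_of_degree_le ?_ ?_) ?_) ?_
  · exact (Polynomial.natDegree_C _).trans_le (Nat.zero_le _)
  · exact (Polynomial.natDegree_C_mul_le _ _).trans (by omega)
  · exact (Polynomial.natDegree_C_mul_le _ _).trans (by omega)
  · exact (Polynomial.natDegree_C_mul_le _ _).trans h3

theorem natDegree_dB_le : (m.dB (Polynomial.X : Polynomial F)).natDegree ≤ 1 := by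
  change (Polynomial.C _ + 2 * Polynomial.C _ * Polynomial.X).natDegree ≤ 1
  compute_degree

theorem natDegree_dA_le : (m.dA (Polynomial.X : Polynomial F)).natDegree ≤ 2 := by
  change (Polynomial.C _ + 2 * Polynomial.C _ * Polynomial.X +
    3 * Polynomial.C _ * Polynomial.X ^ 2).natDegree ≤ 2
  compute_degree

theorem natDegree_disc_le : (m.disc (Polynomial.X : Polynomial F)).natDegree ≤ 4 := by
  have hB := m.natDegree_B_le Polynomial.X
  have hA := m.natDegree_A_le Polynomial.X
  rw [Polynomial.natDegree_X] at hA hB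
  refine (Polynomial.natDegree_sub_le _ _).trans (max_le ?_ ?_)
  · exact Polynomial.natDegree_pow_le.trans (by omega)
  · have : (4 : Polynomial F) = Polynomial.C 4 := rfl
    rw [this]
    exact (Polynomial.natDegree_C_mul_le _ _).trans (by omega)

theorem natDegree_neg_A_X_le : (-m.A (Polynomial.X : Polynomial F)).natDegree ≤ 4 := by
  have hA := m.natDegree_A_le Polynomial.X
  rw [Polynomial.natDegree_X] at hA
  rw [Polynomial.natDegree_neg]
  omega

theorem natDegree_neg_B_X_le : (-m.B (Polynomial.X : Polynomial F)).natDegree ≤ 2 := by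
  have hB := m.natDegree_B_le Polynomial.X
  rw [Polynomial.natDegree_X] at hB
  rwa [Polynomial.natDegree_neg]

/-- The top power of `T` cancels in the norm of `V + b₂(T - X)²`. -/
theorem natDegree_norm_shift_le {T : Polynomial F} (hT : 1 ≤ T.natDegree) :
    (m.A T - Polynomial.C m.b₂ * (T - Polynomial.X) ^ 2 *
      (m.B T - Polynomial.C m.b₂ * (T - Polynomial.X) ^ 2)).natDegree ≤ 3 * T.natDegree + 1 := by
  have h1 : m.B T - Polynomial.C m.b₂ * (T - Polynomial.X) ^ 2 =
      Polynomial.C m.b₀ + (Polynomial.C m.b₁ + Polynomial.C (2 * m.b₂) * Polynomial.X) * T -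
        Polynomial.C m.b₂ * Polynomial.X ^ 2 := by
    rw [B, Polynomial.algebraMap_apply, Algebra.algebraMap_self_apply, Polynomial.algebraMap_apply,
      Algebra.algebraMap_self_apply, Polynomial.algebraMap_apply, Algebra.algebraMap_self_apply]
    simp only [map_mul, map_ofNat]
    ring
  have h2 : (T - Polynomial.X).natDegree ≤ T.natDegree :=
    (Polynomial.natDegree_sub_le _ _).trans (max_le le_rfl (by simpa using hT))
  rw [h1]
  refine (Polynomial.natDegree_sub_le _ _).trans (max_le ((m.natDegree_A_le T).trans (by omega)) ?_)
  refine (Polynomial.natDegree_mul_le_of_le (m := 2 * T.natDegree) (n := T.natDegree + 1)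
    ?_ ?_).trans (by omega)
  · exact (Polynomial.natDegree_C_mul_le _ _).trans
      (Polynomial.natDegree_pow_le.trans (Nat.mul_le_mul_left 2 h2))
  · refine (Polynomial.natDegree_sub_le _ _).trans
      (max_le (Polynomial.natDegree_add_le_of_degree_le ?_ ?_) ?_)
    · simp
    · rw [add_comm T.natDegree]
      refine Polynomial.natDegree_mul_le_of_le ?_ le_rfl
      compute_degree
    · refine (Polynomial.natDegree_C_mul_X_pow_le _ _).trans (by omega)

theorem natDegree_norm_frobTangent_le [Fintype F] :
    (QuadraticAlgebra.norm m.frobTangent).natDegree ≤ 3 * Fintype.card F + 5 := by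
  have hq : 1 < Fintype.card F := Fintype.one_lt_card
  have ha := m.natDegree_neg_A_X_le
  have hb := m.natDegree_neg_B_X_le
  have hω : (ω : m.CoordRing).WeightLE 2 := .of_omega
  have hω' : (star ω : m.CoordRing).WeightLE 2 := hω.conj hb
  have hTX : (Polynomial.X ^ Fintype.card F - Polynomial.X : Polynomial F).natDegree ≤
      Fintype.card F := (FiniteField.X_pow_card_sub_X_natDegree_eq F hq).le
  have hT : (m.t ^ Fintype.card F - m.t).WeightLE (Fintype.card F) := by
    have h : m.t ^ Fintype.card F - m.t =
        algebraMap (Polynomial F) _ (Polynomial.X ^ Fintype.card F - Polynomial.X) := by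
      rw [map_sub, map_pow, t]
    rw [h]
    exact .of_base hTX
  have hdB : (m.dB m.t).WeightLE 1 := by
    rw [t, ← algebraMap_dB]
    exact .of_base m.natDegree_dB_le
  have hdA : (m.dA m.t).WeightLE 2 := by
    rw [t, ← algebraMap_dA]
    exact .of_base m.natDegree_dA_le
  have hbm : (algebraMap F m.CoordRing m.b₂).WeightLE 0 :=
    .of_base (p := Polynomial.C m.b₂) (Polynomial.natDegree_C _).le
  have hlin {x y : m.CoordRing} (hx : x.WeightLE 2) (hy : y.WeightLE 2) :
      (x * y + (y * m.dB m.t + m.dA m.t) * (m.t ^ Fintype.card F - m.t)).WeightLE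
        (3 + Fintype.card F) := by
    have h1 := hx.mul ha hb hy
    have h2 := ((hy.mul ha hb hdB).add (hdA.mono (by norm_num))).mul ha hb hT
    exact (h1.mono (by omega)).add h2
  rw [norm_frobTangent]
  refine Polynomial.natDegree_add_le_of_degree_le
    ((Polynomial.natDegree_sub_le _ _).trans (max_le ?_ ?_)) ?_
  · rw [Polynomial.natDegree_neg]
    have := m.natDegree_norm_shift_le (T := Polynomial.X ^ Fintype.card F)
      (by rw [Polynomial.natDegree_X_pow]; omega)
    rw [Polynomial.natDegree_X_pow] at this
    exact (Polynomial.natDegree_mul_le_of_le m.natDegree_disc_le this).trans (by omega)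
  · refine WeightLE.trace_le hb ?_
    have h1 : (ω ^ Fintype.card F + algebraMap F m.CoordRing m.b₂ * (m.t ^ Fintype.card F - m.t) ^ 2
        ).WeightLE (2 * Fintype.card F) := by
      have h2 := hω.pow ha hb (Fintype.card F)
      have h3 := hbm.mul ha hb (hT.pow ha hb 2)
      rw [zero_add] at h3
      rw [mul_comm] at h2
      exact h2.add h3
    have h4 := ((hω.sub hω').mul ha hb h1).mul ha hb (hlin (hω'.sub hω) hω)
    exact h4.mono (by omega)
  · exact ((hlin (hω.sub hω') hω').norm_le ha hb).trans (by omega)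

end Degree

section Residue

variable {F : Type*} [Field F] (m : DoubleCover F) (t₀ : F)

theorem eval_A_X : (m.A (Polynomial.X : Polynomial F)).eval t₀ = m.A t₀ := by
  simpa using m.map_A (Polynomial.aeval t₀) Polynomial.X

theorem eval_B_X : (m.B (Polynomial.X : Polynomial F)).eval t₀ = m.B t₀ := by
  simpa using m.map_B (Polynomial.aeval t₀) Polynomial.X

theorem eval_disc_X : (m.disc (Polynomial.X : Polynomial F)).eval t₀ = m.disc t₀ := by
  simpa using m.map_disc (Polynomial.aeval t₀) Polynomial.X

/-- The coordinate ring of the fibre of the double cover above `t₀`. -/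
abbrev FibreRing : Type _ := QuadraticAlgebra F (-m.A t₀) (-m.B t₀)

/-- Restriction of functions on the double cover to the fibre above `t₀`. -/
noncomputable def residue : m.CoordRing →+* m.FibreRing t₀ where
  toFun z := ⟨z.re.eval t₀, z.im.eval t₀⟩
  map_zero' := by ext <;> simp
  map_one' := by ext <;> simp
  map_add' x y := by ext <;> simp
  map_mul' x y := by ext <;> simp [eval_A_X, eval_B_X]

theorem residue_omega : m.residue t₀ ω = ω := by
  ext <;> simp [residue]

theorem residue_star (z : m.CoordRing) : m.residue t₀ (star z) = star (m.residue t₀ z) := by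
  ext <;> simp [residue, eval_B_X]

theorem residue_algebraMap (p : Polynomial F) :
    m.residue t₀ (algebraMap (Polynomial F) m.CoordRing p) = algebraMap F _ (p.eval t₀) := by
  ext <;> simp [residue]

theorem dvd_of_residue_eq_zero {z : m.CoordRing} (hz : m.residue t₀ z = 0) :
    algebraMap (Polynomial F) m.CoordRing (Polynomial.X - Polynomial.C t₀) ∣ z := by
  rw [algebraMap_dvd_iff, Polynomial.dvd_iff_isRoot, Polynomial.dvd_iff_isRoot]
  exact ⟨congrArg QuadraticAlgebra.re hz, congrArg QuadraticAlgebra.im hz⟩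

variable {m t₀}

theorem pow_dvd_norm {p : Polynomial F} {z : m.CoordRing} {n : ℕ}
    (h : algebraMap (Polynomial F) m.CoordRing p ^ n ∣ z) :
    p ^ (2 * n) ∣ QuadraticAlgebra.norm z := by
  obtain ⟨w, rfl⟩ := h
  rw [map_mul, map_pow, QuadraticAlgebra.norm_algebraMap, ← pow_mul]
  exact dvd_mul_right _ _

variable [Fintype F]

theorem residue_t_pow_sub : m.residue t₀ (m.t ^ Fintype.card F - m.t) = 0 := by
  rw [t, map_sub, map_pow, residue_algebraMap, ← map_pow, FiniteField.pow_card, sub_self]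

theorem residue_frobTangent :
    m.residue t₀ m.frobTangent = (ω - star ω) * (ω ^ Fintype.card F - star ω) := by
  simp only [frobTangent, tangentNum, map_sub _ (_ * _), map_mul, map_add, map_pow,
    residue_t_pow_sub]
  rw [map_sub, map_sub, residue_star, residue_omega, map_pow, residue_omega]
  ring

theorem pow_four_dvd_norm_frobTangent
    (h : (ω : m.FibreRing t₀) ^ Fintype.card F = star ω) :
    (Polynomial.X - Polynomial.C t₀) ^ 4 ∣ QuadraticAlgebra.norm m.frobTangent := by
  refine pow_dvd_norm (n := 2) (sq_dvd_tangentNum m.omega_add_star ?_ ?_ ?_ ?_)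
  · linear_combination (star ω) * m.omega_add_star - m.omega_mul_star
  · linear_combination (ω ^ Fintype.card F) * m.omega_pow_add_star - m.omega_pow_mul_star
  · exact m.dvd_of_residue_eq_zero t₀ residue_t_pow_sub
  · refine m.dvd_of_residue_eq_zero t₀ ?_
    rw [map_sub, map_pow, residue_star, residue_omega, h, sub_self]

theorem sq_dvd_norm_frobTangent (h : m.disc t₀ = 0) :
    (Polynomial.X - Polynomial.C t₀) ^ 2 ∣ QuadraticAlgebra.norm m.frobTangent := by
  refine pow_dvd_norm (n := 1) ?_
  rw [pow_one]
  refine m.dvd_of_residue_eq_zero t₀ ?_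
  rw [residue_frobTangent]
  exact sub_star_mul_frobenius_sub_star h

end Residue

section Counting

variable {F : Type*} [Field F] {m : DoubleCover F}

/-- The fibre of the double cover above `t` consists of two distinct rational points. -/
def IsSplit (m : DoubleCover F) (t : F) : Prop :=
  ∃ r s : F, r ≠ s ∧ r + s = -m.B t ∧ r * s = m.A t

theorem isSplit_of_root {t v : F} (ht : m.disc t ≠ 0) (hv : v ^ 2 + m.B t * v + m.A t = 0) :
    m.IsSplit t := by
  refine ⟨v, -m.B t - v, fun h => ht ?_, by ring, by linear_combination -hv⟩
  rw [disc]
  linear_combination (2 * v + m.B t) * h - 4 * hv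

theorem sq_omega_sub_star :
    (ω - star ω : m.CoordRing) ^ 2 = algebraMap (Polynomial F) _ (m.disc Polynomial.X) := by
  rw [algebraMap_disc, disc]
  change _ = m.B m.t ^ 2 - 4 * m.A m.t
  rw [← omega_mul_star, ← neg_eq_iff_eq_neg.mpr m.omega_add_star]
  ring

theorem exists_root_of_norm_eq_zero {z : m.CoordRing} (hz : z ≠ 0)
    (h : QuadraticAlgebra.norm z = 0) :
    ∃ v : Polynomial F, v ^ 2 + m.B Polynomial.X * v + m.A Polynomial.X = 0 := by
  obtain ⟨x, y⟩ := z
  rw [norm_def] at h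
  simp only at h
  have hy : y ≠ 0 := by
    rintro rfl
    have hx : x = 0 := by simpa using h
    exact hz (by rw [hx]; rfl)
  have hy' : algebraMap (Polynomial F) (FractionRing (Polynomial F)) y ≠ 0 := by simpa using hy
  have hroot {X Y B A : FractionRing (Polynomial F)} (hY : Y ≠ 0)
      (h : X * X + -B * X * Y - -A * Y * Y = 0) : (-(X / Y)) ^ 2 + B * -(X / Y) + A = 0 := by
    field_simp
    linear_combination h
  have h' := congrArg (algebraMap (Polynomial F) (FractionRing (Polynomial F))) h
  simp only [map_add, map_sub, map_mul, map_neg, map_zero] at h'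
  have hint : IsIntegral (Polynomial F) (-(algebraMap (Polynomial F)
      (FractionRing (Polynomial F)) x / algebraMap _ _ y)) := by
    refine ⟨Polynomial.X ^ 2 + Polynomial.C (m.B Polynomial.X) * Polynomial.X +
      Polynomial.C (m.A Polynomial.X), by monicity!, ?_⟩
    simpa using hroot hy' h'
  obtain ⟨v, hv⟩ := IsIntegrallyClosed.isIntegral_iff.mp hint
  refine ⟨v, IsFractionRing.injective (Polynomial F) (FractionRing (Polynomial F)) ?_⟩
  simpa [hv] using hroot hy' h'

variable [Fintype F]

theorem card_disc_eq_zero_le [DecidableEq F] (hd : m.disc (Polynomial.X : Polynomial F) ≠ 0) :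
    (Finset.univ.filter fun t : F => m.disc t = 0).card ≤ 4 := by
  refine le_trans ?_ ((Polynomial.card_roots' _).trans m.natDegree_disc_le)
  refine (Finset.card_le_card fun t ht => ?_).trans (Multiset.toFinset_card_le _)
  rw [Multiset.mem_toFinset, Polynomial.mem_roots hd, Polynomial.IsRoot, eval_disc_X]
  simpa using ht

theorem five_le_card_isSplit_of_norm_ne_zero [DecidableEq F] [DecidablePred m.IsSplit]
    (hq : 32 ≤ Fintype.card F) (hd : m.disc (Polynomial.X : Polynomial F) ≠ 0)
    (hN : QuadraticAlgebra.norm m.frobTangent ≠ 0) :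
    5 ≤ (Finset.univ.filter fun t => m.IsSplit t).card := by
  let e : F → ℕ := fun t => if m.IsSplit t then 0 else if m.disc t = 0 then 2 else 4
  have hdvd : ∏ t : F, (Polynomial.X - Polynomial.C t) ^ e t ∣
      QuadraticAlgebra.norm m.frobTangent := by
    refine Finset.prod_dvd_of_coprime (fun t _ u _ htu => ?_) fun t _ => ?_
    · exact (Polynomial.pairwise_coprime_X_sub_C Function.injective_id htu).pow
    · simp only [e]
      split_ifs with h1 h2
      · simp
      · exact sq_dvd_norm_frobTangent h2
      · refine pow_four_dvd_norm_frobTangent ((frobenius_omega h2).resolve_left fun h => h1 ?_)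
        exact exists_roots_of_frobenius_omega h2 h
  have hdeg := (Polynomial.natDegree_le_of_dvd hdvd hN).trans m.natDegree_norm_frobTangent_le
  rw [Polynomial.natDegree_prod _ _ fun t _ => pow_ne_zero _ (Polynomial.X_sub_C_ne_zero t)] at hdeg
  simp only [Polynomial.natDegree_pow, Polynomial.natDegree_X_sub_C, mul_one] at hdeg
  have hsum : ∑ _t : F, 4 ≤ ∑ t : F, (e t + 4 * (if m.IsSplit t then 1 else 0) +
      2 * (if m.disc t = 0 then 1 else 0)) := by
    refine Finset.sum_le_sum fun t _ => ?_
    simp only [e]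
    split_ifs <;> norm_num
  rw [Finset.sum_add_distrib, Finset.sum_add_distrib, ← Finset.mul_sum, ← Finset.mul_sum,
    ← Finset.card_filter, ← Finset.card_filter] at hsum
  have hr := card_disc_eq_zero_le hd
  simp only [Finset.sum_const, Finset.card_univ, smul_eq_mul] at hsum
  omega

theorem five_le_card_isSplit_of_norm_eq_zero [DecidableEq F] [DecidablePred m.IsSplit]
    (hq : 32 ≤ Fintype.card F) (hd : m.disc (Polynomial.X : Polynomial F) ≠ 0)
    (hM : m.frobTangent ≠ 0) (hN : QuadraticAlgebra.norm m.frobTangent = 0) :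
    5 ≤ (Finset.univ.filter fun t => m.IsSplit t).card := by
  obtain ⟨v, hv⟩ := exists_root_of_norm_eq_zero hM hN
  have h1 : Finset.univ ⊆ (Finset.univ.filter fun t => m.IsSplit t) ∪
      Finset.univ.filter fun t : F => m.disc t = 0 := by
    intro t _
    simp only [Finset.mem_union, Finset.mem_filter, Finset.mem_univ, true_and]
    refine or_iff_not_imp_right.mpr fun ht => isSplit_of_root (v := v.eval t) ht ?_
    simpa [eval_A_X, eval_B_X] using congrArg (Polynomial.eval t) hv
  have h2 := (Finset.card_le_card h1).trans (Finset.card_union_le _ _)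
  have hr := card_disc_eq_zero_le hd
  rw [Finset.card_univ] at h2
  omega

theorem b₂_eq_zero_of_frobTangent_eq_zero (hd : m.disc (Polynomial.X : Polynomial F) ≠ 0)
    (hM : m.frobTangent = 0) : m.b₂ = 0 := by
  have h := tangentNum_sub_swap m.omega_add_star m.omega_pow_add_star
  rw [← star_frobTangent] at h
  change m.frobTangent - _ = _ at h
  rw [hM, star_zero, sub_zero] at h
  have h1 : algebraMap (Polynomial F) m.CoordRing (Polynomial.C m.b₂ * m.disc Polynomial.X *
      (Polynomial.X ^ Fintype.card F - Polynomial.X) ^ 2) = 0 := by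
    rw [map_mul, map_mul, ← sq_omega_sub_star, map_pow, map_sub, map_pow]
    change algebraMap F m.CoordRing m.b₂ * _ * (m.t ^ Fintype.card F - m.t) ^ 2 = 0
    linear_combination (star ω - ω) * h
  have h2 := (map_eq_zero_iff _ (algebraMap_injective (R := Polynomial F))).mp h1
  have h3 := FiniteField.X_pow_card_sub_X_ne_zero F (Fintype.one_lt_card (α := F))
  simpa [hd, h3] using h2

theorem disc_mul_add_eq_zero (hM : m.frobTangent = 0) (hb : m.b₂ = 0) :
    m.disc (Polynomial.X : Polynomial F) * (Polynomial.C m.a₂ + Polynomial.C m.a₃ *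
        (Polynomial.X ^ Fintype.card F + 2 * Polynomial.X)) +
      (Polynomial.C m.b₁ ^ 2 * m.A Polynomial.X -
        Polynomial.C m.b₁ * m.B Polynomial.X * m.dA Polynomial.X + m.dA Polynomial.X ^ 2) = 0 := by
  have hdB : m.dB m.t = algebraMap F _ m.b₁ := by
    simp [dB, hb]
  have h1 : m.frobTangent = 0 := hM
  have h2 : star m.frobTangent = 0 := by rw [hM, star_zero]
  rw [star_frobTangent] at h2
  rw [frobTangent] at h1
  simp only [tangentNum, hdB, hb, map_zero, zero_mul, add_zero] at h1 h2
  have hs := m.omega_add_star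
  have hp := m.omega_mul_star
  have hP := m.omega_pow_mul_star
  have hδ := m.sq_omega_sub_star
  have h3 := FiniteField.X_pow_card_sub_X_ne_zero F (Fintype.one_lt_card (α := F))
  refine (mul_eq_zero.mp
    (?_ : (Polynomial.X ^ Fintype.card F - Polynomial.X : Polynomial F) ^ 2 * _ = 0)
    ).resolve_left (pow_ne_zero 2 h3)
  apply algebraMap_injective (R := Polynomial F) (a := -m.A Polynomial.X) (b := -m.B Polynomial.X)
  have ht : algebraMap (Polynomial F) m.CoordRing Polynomial.X = m.t := rfl
  have hC (c : F) : algebraMap (Polynomial F) m.CoordRing (Polynomial.C c) = algebraMap F _ c := rfl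
  simp only [map_add, map_sub, map_mul, map_pow, map_zero, algebraMap_disc, algebraMap_A,
    algebraMap_B, algebraMap_dA, ht, hC, map_ofNat] at hδ ⊢
  generalize (ω : m.CoordRing) ^ Fintype.card F = V at *
  generalize m.t ^ Fintype.card F = T at *
  have hA : m.A T - m.A m.t - (T - m.t) * m.dA m.t = (T - m.t) ^ 2 *
      (algebraMap F _ m.a₂ + algebraMap F _ m.a₃ * (T + 2 * m.t)) := by
    simp only [A, dA]
    ring
  rw [← hP, ← hp] at hA
  rw [← hδ, ← hp, ← neg_eq_iff_eq_neg.mpr hs]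
  linear_combination (ω - star ω) * star V * h1 -
    ((ω - star ω) * star ω + (star ω * algebraMap F _ m.b₁ + m.dA m.t) * (T - m.t)) * h2 -
    (ω - star ω) ^ 2 * hA

theorem a₃_eq_zero_of_frobTangent_eq_zero (hq : 32 ≤ Fintype.card F)
    (hd : m.disc (Polynomial.X : Polynomial F) ≠ 0) (hM : m.frobTangent = 0) : m.a₃ = 0 := by
  have h := disc_mul_add_eq_zero hM (b₂_eq_zero_of_frobTangent_eq_zero hd hM)
  have hA := m.natDegree_A_le Polynomial.X
  have hB := m.natDegree_B_le Polynomial.X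
  have hdA := m.natDegree_dA_le
  have hdisc := m.natDegree_disc_le
  rw [Polynomial.natDegree_X] at hA hB
  by_contra ha
  have h1 : (Polynomial.C m.a₂ + Polynomial.C m.a₃ *
      (Polynomial.X ^ Fintype.card F + 2 * Polynomial.X)).natDegree = Fintype.card F := by
    have hlt : (2 * Polynomial.X : Polynomial F).natDegree < Fintype.card F := by
      refine lt_of_le_of_lt (b := 1) (by compute_degree) (by omega)
    have h2 : (Polynomial.X ^ Fintype.card F + 2 * Polynomial.X : Polynomial F).natDegree =
        Fintype.card F := by
      rw [Polynomial.natDegree_add_eq_left_of_natDegree_lt] <;> rw [Polynomial.natDegree_X_pow]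
      exact hlt
    rw [Polynomial.natDegree_C_add, Polynomial.natDegree_C_mul ha, h2]
  have h2 := congrArg Polynomial.natDegree (eq_neg_of_add_eq_zero_left h)
  rw [Polynomial.natDegree_mul hd (by intro h0; rw [h0] at h1; simp at h1; omega), h1,
    Polynomial.natDegree_neg] at h2
  have h3 : (Polynomial.C m.b₁ ^ 2 * m.A Polynomial.X -
      Polynomial.C m.b₁ * m.B Polynomial.X * m.dA Polynomial.X +
        m.dA Polynomial.X ^ 2).natDegree ≤ 4 := by
    refine Polynomial.natDegree_add_le_of_degree_le
      ((Polynomial.natDegree_sub_le _ _).trans (max_le ?_ ?_)) ?_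
    · rw [← map_pow]
      exact (Polynomial.natDegree_C_mul_le _ _).trans (by omega)
    · rw [mul_assoc]
      refine (Polynomial.natDegree_C_mul_le _ _).trans
        ((Polynomial.natDegree_mul_le_of_le hB hdA).trans (by omega))
    · exact Polynomial.natDegree_pow_le.trans (by omega)
  omega

/-- If the Frobenius is tangent to the involution everywhere, the cover is a conic
degenerating to a pair of lines. -/
theorem degenerate_of_frobTangent_eq_zero (hq : 32 ≤ Fintype.card F)
    (hd : m.disc (Polynomial.X : Polynomial F) ≠ 0) (hM : m.frobTangent = 0) :
    m.b₂ = 0 ∧ m.a₃ = 0 ∧ m.a₁ ^ 2 - m.b₀ * m.b₁ * m.a₁ + m.b₁ ^ 2 * m.a₀ + m.a₂ * m.b₀ ^ 2 -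
      4 * m.a₀ * m.a₂ = 0 := by
  have hb := b₂_eq_zero_of_frobTangent_eq_zero hd hM
  have ha := a₃_eq_zero_of_frobTangent_eq_zero hq hd hM
  refine ⟨hb, ha, ?_⟩
  have h := congrArg (Polynomial.eval 0) (disc_mul_add_eq_zero hM hb)
  have hdA : (m.dA (Polynomial.X : Polynomial F)).eval 0 = m.a₁ := by
    simp [dA]
  simp only [Polynomial.eval_add, Polynomial.eval_mul, Polynomial.eval_sub, Polynomial.eval_pow,
    eval_disc_X, eval_A_X, eval_B_X, Polynomial.eval_C, ha, hdA, Polynomial.eval_zero] at h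
  simp [disc, A, B] at h
  linear_combination h

theorem five_le_card_isSplit [DecidablePred m.IsSplit] (hq : 32 ≤ Fintype.card F)
    (hd : m.disc (Polynomial.X : Polynomial F) ≠ 0)
    (h : ¬(m.b₂ = 0 ∧ m.a₃ = 0 ∧ m.a₁ ^ 2 - m.b₀ * m.b₁ * m.a₁ + m.b₁ ^ 2 * m.a₀ +
      m.a₂ * m.b₀ ^ 2 - 4 * m.a₀ * m.a₂ = 0)) :
    5 ≤ (Finset.univ.filter fun t => m.IsSplit t).card := by
  classical
  have hM : m.frobTangent ≠ 0 := fun hM => h (degenerate_of_frobTangent_eq_zero hq hd hM)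
  by_cases hN : QuadraticAlgebra.norm m.frobTangent = 0
  · exact five_le_card_isSplit_of_norm_eq_zero hq hd hM hN
  · exact five_le_card_isSplit_of_norm_ne_zero hq hd hN

end Counting

end DoubleCover

theorem DoubleCover.coeff_of_disc_eq_zero {F : Type*} [Field F] {m : DoubleCover F}
    (hd : m.disc (Polynomial.X : Polynomial F) = 0) :
    m.b₂ = 0 ∧ 4 * m.a₃ = 0 ∧ m.b₁ ^ 2 - 4 * m.a₂ = 0 ∧ m.b₀ * m.b₁ * 2 - 4 * m.a₁ = 0 ∧
      m.b₀ ^ 2 - 4 * m.a₀ = 0 := by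
  have h : m.disc (Polynomial.X : Polynomial F) = Polynomial.C (m.b₂ ^ 2) * Polynomial.X ^ 4 +
      Polynomial.C (2 * m.b₁ * m.b₂ - 4 * m.a₃) * Polynomial.X ^ 3 +
      Polynomial.C (m.b₁ ^ 2 + 2 * m.b₀ * m.b₂ - 4 * m.a₂) * Polynomial.X ^ 2 +
      Polynomial.C (m.b₀ * m.b₁ * 2 - 4 * m.a₁) * Polynomial.X +
      Polynomial.C (m.b₀ ^ 2 - 4 * m.a₀) := by
    simp only [disc, B, A, Polynomial.algebraMap_apply, Algebra.algebraMap_self_apply, map_sub,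
      map_add, map_mul, map_pow, map_ofNat]
    ring
  rw [hd] at h
  have h4 := congrArg (Polynomial.coeff · 4) h
  have h3 := congrArg (Polynomial.coeff · 3) h
  have h2 := congrArg (Polynomial.coeff · 2) h
  have h1 := congrArg (Polynomial.coeff · 1) h
  have h0 := congrArg (Polynomial.coeff · 0) h
  simp only [Polynomial.coeff_zero, Polynomial.coeff_add, Polynomial.coeff_C_mul_X_pow,
    Polynomial.coeff_C_mul_X, Polynomial.coeff_C] at h4 h3 h2 h1 h0
  norm_num at h4 h3 h2 h1 h0
  have hb : m.b₂ = 0 := pow_eq_zero_iff two_ne_zero |>.mp h4.symm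
  rw [hb] at h2 h3
  exact ⟨hb, by linear_combination h3, by linear_combination -h2, by linear_combination -h1,
    by linear_combination -h0⟩


section ConicPencil

variable {F : Type*} [Field F]

/-- A conic `v² + (b₀w + b₁τ)v + a₀w² + a₁wτ + a₂τ²` with vanishing discriminant has a rational
singular point, except possibly when it is a diagonal form in characteristic two. -/
theorem exists_singular_point_of_conic {b₀ b₁ a₀ a₁ a₂ : F}
    (hΔ : a₁ ^ 2 - b₀ * b₁ * a₁ + b₁ ^ 2 * a₀ + a₂ * b₀ ^ 2 - 4 * a₀ * a₂ = 0)
    (h2 : (2 : F) ≠ 0 ∨ b₀ ≠ 0 ∨ b₁ ≠ 0) :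
    ∃ v τ w : F, (τ ≠ 0 ∨ w ≠ 0) ∧ 2 * v + b₀ * w + b₁ * τ = 0 ∧
      b₀ * v + 2 * a₀ * w + a₁ * τ = 0 ∧ b₁ * v + a₁ * w + 2 * a₂ * τ = 0 ∧
      v ^ 2 + (b₀ * w + b₁ * τ) * v + a₀ * w ^ 2 + a₁ * w * τ + a₂ * τ ^ 2 = 0 := by
  by_cases h₀ : 4 * a₀ - b₀ ^ 2 = 0
  · by_cases h₂ : 4 * a₂ - b₁ ^ 2 = 0
    · by_cases h₁ : b₀ * b₁ - 2 * a₁ = 0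
      · have h2' : (2 : F) ≠ 0 := by
          rcases h2 with h | h | h
          · exact h
          · intro h'
            refine h (pow_eq_zero_iff two_ne_zero |>.mp ?_)
            linear_combination -h₀ + 2 * a₀ * h'
          · intro h'
            refine h (pow_eq_zero_iff two_ne_zero |>.mp ?_)
            linear_combination -h₂ + 2 * a₂ * h'
        refine ⟨-b₀, 0, 2, .inr h2', ?_, ?_, ?_, ?_⟩
        · ring
        · linear_combination h₀
        · linear_combination -h₁
        · linear_combination h₀
      · refine ⟨a₁ * b₀ - 2 * a₀ * b₁, 4 * a₀ - b₀ ^ 2, b₀ * b₁ - 2 * a₁, .inr h₁, ?_, ?_, ?_, ?_⟩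
        · ring
        · ring
        · linear_combination (-2) * hΔ
        · linear_combination -(4 * a₀ - b₀ ^ 2) * hΔ
    · refine ⟨a₁ * b₁ - 2 * a₂ * b₀, b₀ * b₁ - 2 * a₁, 4 * a₂ - b₁ ^ 2, .inr h₂, ?_, ?_, ?_, ?_⟩
      · ring
      · linear_combination (-2) * hΔ
      · ring
      · linear_combination -(4 * a₂ - b₁ ^ 2) * hΔ
  · refine ⟨a₁ * b₀ - 2 * a₀ * b₁, 4 * a₀ - b₀ ^ 2, b₀ * b₁ - 2 * a₁, .inl h₀, ?_, ?_, ?_, ?_⟩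
    · ring
    · ring
    · linear_combination (-2) * hΔ
    · linear_combination -(4 * a₀ - b₀ ^ 2) * hΔ

/-- Two quaternary quadratic forms `Y₀Z₁ + s₁(Z₁, Z₂, Z₃)` and `Y₀Z₂ + s₂(Z₁, Z₂, Z₃)`, where
`s₁ = c₁Z₁² + c₂Z₂² + Z₃² + c₄Z₁Z₂ + c₅Z₁Z₃ + c₆Z₂Z₃` and
`s₂ = d₁Z₁² + d₂Z₂² + d₄Z₁Z₂ + d₅Z₁Z₃ + d₆Z₂Z₃`. -/
structure NormalPair (F : Type*) where
  (c₁ c₂ c₄ c₅ c₆ d₁ d₂ d₄ d₅ d₆ : F)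

namespace NormalPair

section Evaluation

variable {R : Type*} [CommRing R] [Algebra F R] (n : NormalPair F)

/-- The first form. -/
def fst (y₀ z₁ z₂ z₃ : R) : R :=
  y₀ * z₁ + (algebraMap F R n.c₁ * z₁ ^ 2 + algebraMap F R n.c₂ * z₂ ^ 2 + z₃ ^ 2 +
    algebraMap F R n.c₄ * z₁ * z₂ + algebraMap F R n.c₅ * z₁ * z₃ + algebraMap F R n.c₆ * z₂ * z₃)

/-- The second form. -/
def snd (y₀ z₁ z₂ z₃ : R) : R :=
  y₀ * z₂ + (algebraMap F R n.d₁ * z₁ ^ 2 + algebraMap F R n.d₂ * z₂ ^ 2 +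
    algebraMap F R n.d₄ * z₁ * z₂ + algebraMap F R n.d₅ * z₁ * z₃ + algebraMap F R n.d₆ * z₂ * z₃)

/-- The double cover of the pencil which parametrizes the lines through `(1 : 0 : 0 : 0)` on the
members of the pencil. -/
def cover : DoubleCover F :=
  ⟨n.c₆, n.d₆ - n.c₅, -n.d₅, n.c₂, n.d₂ - n.c₄, n.c₁ - n.d₄, n.d₁⟩

/-- A singular common zero of a pair of forms, in coordinates. -/
structure IsSingularZero (y₀ z₁ z₂ z₃ α β : F) : Prop where
  ne_zero : z₁ ≠ 0 ∨ z₂ ≠ 0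
  coeff_ne_zero : α ≠ 0 ∨ β ≠ 0
  fst_eq : n.fst y₀ z₁ z₂ z₃ = 0
  snd_eq : n.snd y₀ z₁ z₂ z₃ = 0
  d_zero : α * z₁ = β * z₂
  d_one : α * (y₀ + 2 * n.c₁ * z₁ + n.c₄ * z₂ + n.c₅ * z₃) =
    β * (2 * n.d₁ * z₁ + n.d₄ * z₂ + n.d₅ * z₃)
  d_two : α * (2 * n.c₂ * z₂ + n.c₄ * z₁ + n.c₆ * z₃) =
    β * (y₀ + 2 * n.d₂ * z₂ + n.d₄ * z₁ + n.d₆ * z₃)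
  d_three : α * (2 * z₃ + n.c₅ * z₁ + n.c₆ * z₂) = β * (n.d₅ * z₁ + n.d₆ * z₂)

end Evaluation

variable {n : NormalPair F}

theorem exists_isSingularZero_of_conic (hb : n.cover.b₂ = 0) (ha : n.cover.a₃ = 0)
    (hΔ : n.cover.a₁ ^ 2 - n.cover.b₀ * n.cover.b₁ * n.cover.a₁ + n.cover.b₁ ^ 2 * n.cover.a₀ +
      n.cover.a₂ * n.cover.b₀ ^ 2 - 4 * n.cover.a₀ * n.cover.a₂ = 0)
    (h2 : (2 : F) ≠ 0 ∨ n.cover.b₀ ≠ 0 ∨ n.cover.b₁ ≠ 0) :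
    ∃ y₀ z₁ z₂ z₃ α β, n.IsSingularZero y₀ z₁ z₂ z₃ α β := by
  obtain ⟨v, τ, w, hne, hv, hw, hτ, h⟩ := exists_singular_point_of_conic hΔ h2
  simp only [cover, neg_eq_zero] at *
  refine ⟨-(n.d₄ * -τ + n.d₂ * w + n.d₆ * v), -τ, w, v, w, -τ, by simpa using hne,
    by simpa using hne.symm, ?_, ?_, by ring, ?_, ?_, ?_⟩
  · simp only [fst, Algebra.algebraMap_self_apply]
    linear_combination h
  · simp only [snd, Algebra.algebraMap_self_apply]
    rw [hb, ha]
    ring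
  · rw [hb, ha]
    linear_combination -w * hτ
  · linear_combination w * hw
  · rw [hb]
    linear_combination w * hv

theorem exists_isSingularZero_of_two_eq_zero [Finite F] (h2 : (2 : F) = 0) (h₀ : n.cover.b₀ = 0)
    (h₁ : n.cover.b₁ = 0) (h₂ : n.cover.b₂ = 0) :
    ∃ y₀ z₁ z₂ z₃ α β, n.IsSingularZero y₀ z₁ z₂ z₃ α β := by
  simp only [cover, neg_eq_zero, sub_eq_zero] at h₀ h₁ h₂
  have : CharP F 2 := CharTwo.of_one_ne_zero_of_two_eq_zero one_ne_zero h2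
  have hsq (x : F) : ∃ y, x = y ^ 2 := by
    obtain ⟨y, hy⟩ := FiniteField.isSquare_of_char_two (ringChar.eq F 2) x
    exact ⟨y, hy.trans (sq y).symm⟩
  obtain ⟨z₁, z₂, hz, h⟩ :
      ∃ z₁ z₂ : F, (z₁ ≠ 0 ∨ z₂ ≠ 0) ∧ n.d₁ * z₁ ^ 2 + (n.c₄ + n.d₂) * z₂ ^ 2 = 0 := by
    by_cases hd : n.d₁ = 0
    · exact ⟨1, 0, .inl one_ne_zero, by rw [hd]; ring⟩
    · obtain ⟨z₁, hz₁⟩ := hsq (n.c₄ + n.d₂)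
      obtain ⟨z₂, hz₂⟩ := hsq n.d₁
      refine ⟨z₁, z₂, .inr ?_, ?_⟩
      · rintro rfl
        exact hd (by simpa using hz₂)
      · rw [hz₂, hz₁]
        linear_combination z₁ ^ 2 * z₂ ^ 2 * h2
  obtain ⟨z₃, hz₃⟩ := hsq ((n.c₁ + n.d₄) * z₁ ^ 2 + n.c₂ * z₂ ^ 2)
  refine ⟨n.c₄ * z₂ + n.c₅ * z₃ + n.d₄ * z₁, z₁, z₂, z₃, z₂, z₁, hz, hz.symm, ?_, ?_, by ring,
    ?_, ?_, ?_⟩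
  · simp only [fst, Algebra.algebraMap_self_apply]
    rw [h₀, ← hz₃]
    linear_combination (n.c₄ * z₁ * z₂ + n.c₅ * z₁ * z₃ + n.d₄ * z₁ ^ 2 + n.c₁ * z₁ ^ 2 +
      n.c₂ * z₂ ^ 2) * h2
  · simp only [snd, Algebra.algebraMap_self_apply]
    rw [h₁, h₂]
    linear_combination h + (n.c₅ * z₂ * z₃ + n.d₄ * z₁ * z₂) * h2
  · rw [h₂]
    linear_combination (n.c₄ * z₂ ^ 2 + n.c₅ * z₂ * z₃ + n.c₁ * z₁ * z₂ - n.d₁ * z₁ ^ 2) * h2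
  · rw [h₀, h₁]
    linear_combination (n.c₂ * z₂ ^ 2 - n.c₅ * z₁ * z₃ - n.d₄ * z₁ ^ 2 - n.d₂ * z₁ * z₂) * h2
  · rw [h₀, h₁, h₂]
    linear_combination z₂ * z₃ * h2

theorem exists_isSingularZero_of_disc_eq_zero [Finite F]
    (hd : n.cover.disc (Polynomial.X : Polynomial F) = 0) :
    ∃ y₀ z₁ z₂ z₃ α β, n.IsSingularZero y₀ z₁ z₂ z₃ α β := by
  obtain ⟨hb, h3, hq, hl, hc⟩ := DoubleCover.coeff_of_disc_eq_zero hd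
  by_cases h2 : (2 : F) = 0
  · refine exists_isSingularZero_of_two_eq_zero h2 ?_ ?_ hb
    · refine pow_eq_zero_iff two_ne_zero |>.mp ?_
      linear_combination hc + 2 * n.cover.a₀ * h2
    · refine pow_eq_zero_iff two_ne_zero |>.mp ?_
      linear_combination hq + 2 * n.cover.a₂ * h2
  · have ha : n.cover.a₃ = 0 := by simpa [h2, show (4 : F) = 2 * 2 by norm_num] using h3
    refine exists_isSingularZero_of_conic hb ha ?_ (.inl h2)
    have hu : 2 * n.cover.a₁ - n.cover.b₀ * n.cover.b₁ = 0 :=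
      (mul_eq_zero.mp (by linear_combination -hl : (2 : F) * _ = 0)).resolve_left h2
    refine (mul_eq_zero.mp (?_ : (2 * 2 : F) * _ = 0)).resolve_left (mul_ne_zero h2 h2)
    linear_combination (2 * n.cover.a₁ - n.cover.b₀ * n.cover.b₁) * hu -
      (n.cover.b₀ ^ 2 - 4 * n.cover.a₀) * hq

end NormalPair

end ConicPencil

section Hyperbolic

variable {F : Type*} [Field F] {k : ℕ}

theorem substMat_inv_linearForm {S : Matrix (Fin k) (Fin k) F} (hS : IsUnit S.det) (i : Fin k) :
    substMat S⁻¹ (∑ j, C (S i j) * X j) = X i := by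
  have h : ∀ l, ∑ j, S i j * S⁻¹ j l = if i = l then 1 else 0 := fun l => by
    rw [← Matrix.mul_apply, Matrix.mul_nonsing_inv _ hS, Matrix.one_apply]
  simp only [substMat, map_sum, map_mul (aeval _), aeval_C, aeval_X, algebraMap_eq,
    Finset.mul_sum, ← mul_assoc, ← C_mul]
  rw [Finset.sum_comm]
  simp only [← Finset.sum_mul, ← map_sum C, h]
  simp

theorem exists_substMat_eq_of_linearForms (S : Matrix (Fin 4) (Fin 4) F) (hS : IsUnit S.det)
    {p : MvPolynomial (Fin 4) F}
    (hp : p = (∑ j, C (S 0 j) * X j) * (∑ j, C (S 1 j) * X j) +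
      (∑ j, C (S 2 j) * X j) * (∑ j, C (S 3 j) * X j)) :
    ∃ T : Matrix (Fin 4) (Fin 4) F, IsUnit T.det ∧ substMat T p = X 0 * X 1 + X 2 * X 3 := by
  refine ⟨S⁻¹, Matrix.isUnit_nonsing_inv_det S hS, ?_⟩
  have h := substMat_inv_linearForm hS
  simp only [substMat] at h ⊢
  rw [hp, map_add, map_mul, map_mul, h, h, h, h]

end Hyperbolic

section PencilCoordinates

variable {F : Type*} [Field F]

theorem MvPolynomial.IsHomogeneous.exists_eq_ternary {s : MvPolynomial (Fin 4) F}
    (hs : s.IsHomogeneous 2) (hvars : ∀ i ∈ s.vars, 1 ≤ (i : ℕ)) :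
    ∃ g₁₁ g₂₂ g₃₃ g₁₂ g₁₃ g₂₃ : F, s = C g₁₁ * X 1 ^ 2 + C g₂₂ * X 2 ^ 2 + C g₃₃ * X 3 ^ 2 +
      C g₁₂ * X 1 * X 2 + C g₁₃ * X 1 * X 3 + C g₂₃ * X 2 * X 3 := by
  rw [s.as_sum]
  refine Finset.sum_induction _ (fun p => ∃ g₁₁ g₂₂ g₃₃ g₁₂ g₁₃ g₂₃ : F, p = C g₁₁ * X 1 ^ 2 +
    C g₂₂ * X 2 ^ 2 + C g₃₃ * X 3 ^ 2 + C g₁₂ * X 1 * X 2 + C g₁₃ * X 1 * X 3 + C g₂₃ * X 2 * X 3)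
    ?_ ⟨0, 0, 0, 0, 0, 0, by simp⟩ ?_
  · rintro _ _ ⟨a₁, a₂, a₃, a₄, a₅, a₆, rfl⟩ ⟨b₁, b₂, b₃, b₄, b₅, b₆, rfl⟩
    refine ⟨a₁ + b₁, a₂ + b₂, a₃ + b₃, a₄ + b₄, a₅ + b₅, a₆ + b₆, ?_⟩
    simp only [C_add]
    ring
  · intro d hd
    have h0 : d 0 = 0 := by
      by_contra h
      have := hvars 0 ((mem_vars_iff_mem_support 0).mpr ⟨d, hd, Finsupp.mem_support_iff.mpr h⟩)
      simp at this
    have hdeg := hs (mem_support_iff.mp hd)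
    rw [Finsupp.weight_apply, Finsupp.sum_fintype _ _ (by simp), Fin.sum_univ_four, h0] at hdeg
    simp only [Pi.one_apply, smul_eq_mul, mul_one, zero_add] at hdeg
    rw [monomial_eq, Finsupp.prod_fintype _ _ (by simp), Fin.prod_univ_four, h0]
    generalize coeff d s = c
    generalize d 1 = i at *
    generalize d 2 = j at *
    generalize d 3 = l at *
    have hcases : (i = 2 ∧ j = 0 ∧ l = 0) ∨ (i = 0 ∧ j = 2 ∧ l = 0) ∨ (i = 0 ∧ j = 0 ∧ l = 2) ∨
      (i = 1 ∧ j = 1 ∧ l = 0) ∨ (i = 1 ∧ j = 0 ∧ l = 1) ∨ (i = 0 ∧ j = 1 ∧ l = 1) := by omega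
    rcases hcases with ⟨rfl, rfl, rfl⟩ | ⟨rfl, rfl, rfl⟩ | ⟨rfl, rfl, rfl⟩ | ⟨rfl, rfl, rfl⟩ |
      ⟨rfl, rfl, rfl⟩ | ⟨rfl, rfl, rfl⟩
    · exact ⟨c, 0, 0, 0, 0, 0, by simp⟩
    · exact ⟨0, c, 0, 0, 0, 0, by simp⟩
    · exact ⟨0, 0, c, 0, 0, 0, by simp⟩
    · exact ⟨0, 0, 0, c, 0, 0, by simp [mul_assoc]⟩
    · exact ⟨0, 0, 0, 0, c, 0, by simp [mul_assoc]⟩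
    · exact ⟨0, 0, 0, 0, 0, c, by simp [mul_assoc]⟩

/-- A pair of forms `q₁, q₂` in the variables `Y₀, Y₁, Y₂, Y₃` which, after unimodular changes
`e, f` of the basis of the pencil and of the pair `Y₁, Y₂`, is a normal pair. -/
structure NormalPair.Presents (n : NormalPair F) (e₁ e₂ f₁ f₂ : F)
    (q₁ q₂ : MvPolynomial (Fin 4) F) : Prop where
  det_eq : e₁ * f₂ - e₂ * f₁ = 1
  fst_eq : C e₁ * q₁ + C e₂ * q₂ =
    n.fst (X 0) (C e₁ * X 1 + C e₂ * X 2) (C f₁ * X 1 + C f₂ * X 2) (X 3)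
  snd_eq : C f₁ * q₁ + C f₂ * q₂ =
    n.snd (X 0) (C e₁ * X 1 + C e₂ * X 2) (C f₁ * X 1 + C f₂ * X 2) (X 3)

theorem exists_presents {s₁ s₂ : MvPolynomial (Fin 4) F} (hs₁ : s₁.IsHomogeneous 2)
    (hs₂ : s₂.IsHomogeneous 2) (hs₁vars : ∀ i ∈ s₁.vars, 1 ≤ (i : ℕ))
    (hs₂vars : ∀ i ∈ s₂.vars, 1 ≤ (i : ℕ))
    (h : ¬ (eval (fun i : Fin 4 => if (i : ℕ) = 3 then (1 : F) else 0) s₁ = 0 ∧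
      eval (fun i : Fin 4 => if (i : ℕ) = 3 then (1 : F) else 0) s₂ = 0)) :
    ∃ (n : NormalPair F) (e₁ e₂ f₁ f₂ : F),
      n.Presents e₁ e₂ f₁ f₂ (X 0 * X 1 + s₁) (X 0 * X 2 + s₂) := by
  obtain ⟨g₁, g₂, g₃, g₄, g₅, g₆, rfl⟩ := hs₁.exists_eq_ternary hs₁vars
  obtain ⟨h₁, h₂, h₃, h₄, h₅, h₆, rfl⟩ := hs₂.exists_eq_ternary hs₂vars
  simp at h
  obtain ⟨e₁, e₂, he⟩ : ∃ e₁ e₂ : F, e₁ * g₃ + e₂ * h₃ = 1 := by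
    by_cases hg : g₃ = 0
    · exact ⟨0, h₃⁻¹, by rw [inv_mul_cancel₀ (h hg)]; ring⟩
    · exact ⟨g₃⁻¹, 0, by rw [inv_mul_cancel₀ hg]; ring⟩
  have hC : (C e₁ * C g₃ + C e₂ * C h₃ : MvPolynomial (Fin 4) F) = 1 := by
    rw [← C_mul, ← C_mul, ← C_add, he, C_1]
  let coeffs (a b : F) : Fin 5 → F :=
    ![(a * g₁ + b * h₁) * g₃ ^ 2 + (a * g₂ + b * h₂) * h₃ ^ 2 + (a * g₄ + b * h₄) * g₃ * h₃,
      (a * g₁ + b * h₁) * e₂ ^ 2 + (a * g₂ + b * h₂) * e₁ ^ 2 - (a * g₄ + b * h₄) * e₁ * e₂,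
      -2 * (a * g₁ + b * h₁) * e₂ * g₃ + 2 * (a * g₂ + b * h₂) * e₁ * h₃ +
        (a * g₄ + b * h₄) * (e₁ * g₃ - e₂ * h₃),
      (a * g₅ + b * h₅) * g₃ + (a * g₆ + b * h₆) * h₃,
      (a * g₆ + b * h₆) * e₁ - (a * g₅ + b * h₅) * e₂]
  have hX₁ : (X 1 : MvPolynomial (Fin 4) F) = C g₃ * (C e₁ * X 1 + C e₂ * X 2) -
      C e₂ * (C (-h₃) * X 1 + C g₃ * X 2) := by
    rw [C_neg]
    linear_combination -X 1 * hC
  have hX₂ : (X 2 : MvPolynomial (Fin 4) F) = C h₃ * (C e₁ * X 1 + C e₂ * X 2) +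
      C e₁ * (C (-h₃) * X 1 + C g₃ * X 2) := by
    rw [C_neg]
    linear_combination -X 2 * hC
  have key (a b : F) {x₁ x₂ z₁ z₂ : MvPolynomial (Fin 4) F} (hx₁ : x₁ = C g₃ * z₁ - C e₂ * z₂)
      (hx₂ : x₂ = C h₃ * z₁ + C e₁ * z₂) :
      C a * (C g₁ * x₁ ^ 2 + C g₂ * x₂ ^ 2 + C g₃ * X 3 ^ 2 + C g₄ * x₁ * x₂ + C g₅ * x₁ * X 3 +
        C g₆ * x₂ * X 3) + C b * (C h₁ * x₁ ^ 2 + C h₂ * x₂ ^ 2 + C h₃ * X 3 ^ 2 +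
        C h₄ * x₁ * x₂ + C h₅ * x₁ * X 3 + C h₆ * x₂ * X 3) =
      C (coeffs a b 0) * z₁ ^ 2 + C (coeffs a b 1) * z₂ ^ 2 + (C a * C g₃ + C b * C h₃) * X 3 ^ 2 +
        C (coeffs a b 2) * z₁ * z₂ + C (coeffs a b 3) * z₁ * X 3 +
        C (coeffs a b 4) * z₂ * X 3 := by
    subst hx₁ hx₂
    have h2 : (C 2 : MvPolynomial (Fin 4) F) = 2 := map_ofNat C 2
    simp [coeffs, h2]
    ring
  refine ⟨⟨coeffs e₁ e₂ 0, coeffs e₁ e₂ 1, coeffs e₁ e₂ 2, coeffs e₁ e₂ 3, coeffs e₁ e₂ 4,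
    coeffs (-h₃) g₃ 0, coeffs (-h₃) g₃ 1, coeffs (-h₃) g₃ 2, coeffs (-h₃) g₃ 3,
    coeffs (-h₃) g₃ 4⟩, e₁, e₂, -h₃, g₃, by linear_combination he, ?_, ?_⟩
  · simp only [NormalPair.fst, algebraMap_eq]
    linear_combination key e₁ e₂ hX₁ hX₂ + X 3 ^ 2 * hC
  · simp only [NormalPair.snd, algebraMap_eq]
    have h0 : (C (-h₃) * C g₃ + C g₃ * C h₃ : MvPolynomial (Fin 4) F) = 0 := by
      rw [C_neg]
      ring
    linear_combination key (-h₃) g₃ hX₁ hX₂ + X 3 ^ 2 * h0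

namespace NormalPair.Presents

variable {n : NormalPair F} {e₁ e₂ f₁ f₂ : F} {q₁ q₂ : MvPolynomial (Fin 4) F}

theorem exists_singular_zero (h : n.Presents e₁ e₂ f₁ f₂ q₁ q₂) {y₀ z₁ z₂ z₃ α β : F}
    (hz : n.IsSingularZero y₀ z₁ z₂ z₃ α β) :
    ∃ y : Fin 4 → F, y ≠ 0 ∧ eval y q₁ = 0 ∧ eval y q₂ = 0 ∧ ∃ a b : F, (a ≠ 0 ∨ b ≠ 0) ∧
      ∀ j : Fin 4, a * eval y (pderiv j q₁) = b * eval y (pderiv j q₂) := by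
  have hdet := h.det_eq
  have hZ₁ : e₁ * (f₂ * z₁ - e₂ * z₂) + e₂ * (e₁ * z₂ - f₁ * z₁) = z₁ := by
    linear_combination z₁ * hdet
  have hZ₂ : f₁ * (f₂ * z₁ - e₂ * z₂) + f₂ * (e₁ * z₂ - f₁ * z₁) = z₂ := by
    linear_combination z₂ * hdet
  have h₁ := congrArg (eval ![y₀, f₂ * z₁ - e₂ * z₂, e₁ * z₂ - f₁ * z₁, z₃]) h.fst_eq
  have h₂ := congrArg (eval ![y₀, f₂ * z₁ - e₂ * z₂, e₁ * z₂ - f₁ * z₁, z₃]) h.snd_eq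
  have hf : eval ![y₀, f₂ * z₁ - e₂ * z₂, e₁ * z₂ - f₁ * z₁, z₃] (C e₁ * q₁ + C e₂ * q₂) = 0 := by
    rw [h₁, ← hz.fst_eq]
    simp [fst, hZ₁, hZ₂]
  have hs : eval ![y₀, f₂ * z₁ - e₂ * z₂, e₁ * z₂ - f₁ * z₁, z₃] (C f₁ * q₁ + C f₂ * q₂) = 0 := by
    rw [h₂, ← hz.snd_eq]
    simp [snd, hZ₁, hZ₂]
  simp only [map_add, map_mul, eval_C] at hf hs
  refine ⟨![y₀, f₂ * z₁ - e₂ * z₂, e₁ * z₂ - f₁ * z₁, z₃], ?_, ?_, ?_, α * e₁ - β * f₁,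
    β * f₂ - α * e₂, ?_, fun j => ?_⟩
  · intro h0
    have h1 : f₂ * z₁ - e₂ * z₂ = 0 := congrFun h0 1
    have h2 : e₁ * z₂ - f₁ * z₁ = 0 := congrFun h0 2
    rw [h1, h2] at hZ₁ hZ₂
    rcases hz.ne_zero with h | h
    · exact h (by rw [← hZ₁]; ring)
    · exact h (by rw [← hZ₂]; ring)
  · linear_combination f₂ * hf - e₂ * hs - eval _ q₁ * hdet
  · linear_combination e₁ * hs - f₁ * hf - eval _ q₂ * hdet
  · by_contra! h0
    rcases hz.coeff_ne_zero with h | h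
    · exact h (by linear_combination f₂ * h0.1 + f₁ * h0.2 - α * hdet)
    · exact h (by linear_combination e₂ * h0.1 + e₁ * h0.2 - β * hdet)
  · set y : Fin 4 → F := ![y₀, f₂ * z₁ - e₂ * z₂, e₁ * z₂ - f₁ * z₁, z₃] with hy
    have g₁ := congrArg (fun p => eval y (pderiv j p)) h.fst_eq
    have g₂ := congrArg (fun p => eval y (pderiv j p)) h.snd_eq
    have hd₀ := hz.d_zero
    have hd₁ := hz.d_one
    have hd₂ := hz.d_two
    have hd₃ := hz.d_three
    fin_cases j
    all_goals
      simp [fst, snd, pderiv_X, Derivation.leibniz_pow, hy, hZ₁, hZ₂] at g₁ g₂ ⊢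
    · linear_combination α * g₁ - β * g₂ + hd₀
    · linear_combination α * g₁ - β * g₂ + e₁ * hd₁ + f₁ * hd₂
    · linear_combination α * g₁ - β * g₂ + e₂ * hd₁ + f₂ * hd₂
    · linear_combination α * g₁ - β * g₂ + hd₃

theorem exists_substMat_eq (h : n.Presents e₁ e₂ f₁ f₂ q₁ q₂) {t c : F} (hc : c ≠ 0)
    (ht : n.cover.IsSplit t) :
    ∃ T : Matrix (Fin 4) (Fin 4) F, IsUnit T.det ∧
      substMat T (C (c * (e₁ + t * f₁)) * q₁ + C (c * (e₂ + t * f₂)) * q₂) =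
        X 0 * X 1 + X 2 * X 3 := by
  obtain ⟨r, s, hrs, hadd, hmul⟩ := ht
  simp only [DoubleCover.A, DoubleCover.B, cover, Algebra.algebraMap_self_apply] at hadd hmul
  let a := n.c₁ + t * n.d₁
  let b := n.c₄ + t * n.d₄ - t * a
  refine exists_substMat_eq_of_linearForms
    !![0, c * (e₁ + t * f₁), c * (e₂ + t * f₂), 0;
      1, a * e₁ + b * f₁, a * e₂ + b * f₂, n.c₅ + t * n.d₅;
      0, -(c * r * f₁), -(c * r * f₂), c;
      0, -(s * f₁), -(s * f₂), 1] ?_ ?_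
  · rw [isUnit_iff_ne_zero]
    have hdet : c ^ 2 * (r - s) ≠ 0 := mul_ne_zero (pow_ne_zero _ hc) (sub_ne_zero.mpr hrs)
    convert hdet using 1
    simp [Matrix.det_succ_row_zero, Fin.sum_univ_succ, Fin.succAbove]
    linear_combination (c ^ 2 * (r - s)) * h.det_eq
  · have hf := h.fst_eq
    have hs := h.snd_eq
    have hadd' := congrArg (C : F → MvPolynomial (Fin 4) F) hadd
    have hmul' := congrArg (C : F → MvPolynomial (Fin 4) F) hmul
    simp [Fin.sum_univ_four, a, b, fst, snd] at hf hs hadd' hmul' ⊢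
    linear_combination C c * hf + C c * C t * hs - C c * (C f₁ * X 1 + C f₂ * X 2) ^ 2 * hmul' +
      C c * (C f₁ * X 1 + C f₂ * X 2) * X 3 * hadd'

theorem card_mul_le_card [Finite F] (h : n.Presents e₁ e₂ f₁ f₂ q₁ q₂) (s : Finset F)
    (hs : ∀ t ∈ s, n.cover.IsSplit t) :
    s.card * (Nat.card F - 1) ≤ Nat.card {p : F × F // p ≠ 0 ∧
      ∃ T : Matrix (Fin 4) (Fin 4) F, IsUnit T.det ∧
        substMat T (C p.1 * q₁ + C p.2 * q₂) = X 0 * X 1 + X 2 * X 3} := by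
  have hdet := h.det_eq
  have hc (t c : F) : c * (e₁ + t * f₁) * f₂ - c * (e₂ + t * f₂) * f₁ = c := by
    linear_combination c * hdet
  have ht (t c : F) : c * (e₂ + t * f₂) * e₁ - c * (e₁ + t * f₁) * e₂ = c * t := by
    linear_combination c * t * hdet
  rw [← Nat.card_units, ← Nat.card_eq_finsetCard, ← Nat.card_prod]
  refine Nat.card_le_card_of_injective (fun x : s × Fˣ =>
    ⟨(x.2 * (e₁ + x.1 * f₁), x.2 * (e₂ + x.1 * f₂)), fun h0 => x.2.ne_zero ?_,
      h.exists_substMat_eq x.2.ne_zero (hs x.1 x.1.2)⟩) ?_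
  · have h1 := congrArg Prod.fst h0
    have h2 := congrArg Prod.snd h0
    simp only [Prod.fst_zero, Prod.snd_zero] at h1 h2
    rw [← hc x.1 x.2, h1, h2, zero_mul, zero_mul, sub_zero]
  · rintro ⟨t₁, c₁⟩ ⟨t₂, c₂⟩ heq
    simp only [Subtype.mk.injEq, Prod.mk.injEq] at heq
    have h1 := hc t₁ c₁
    have h2 := ht t₁ c₁
    rw [heq.1, heq.2, hc] at h1
    rw [heq.1, heq.2, ht, h1] at h2
    exact Prod.ext (Subtype.ext (mul_left_cancel₀ c₁.ne_zero h2.symm)) (Units.ext h1.symm)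

end NormalPair.Presents

end PencilCoordinates

/-- Lemma `7l`: let `F` be a finite field with `#F ≥ 32`, and let
`q₁ = Y₀Y₁ + s₁(Y₁,Y₂,Y₃)`, `q₂ = Y₀Y₂ + s₂(Y₁,Y₂,Y₃)` be quadratic forms in 4 variables over
`F`, where `s₁, s₂` are ternary quadratic forms (in the last three variables) which do not both
vanish at `(Y₁,Y₂,Y₃) = (0,0,1)`.  Then either `q₁, q₂` have a singular common zero over `F`, or
at least `5(#F - 1)` nonzero pairs `(a,b) ∈ F²` make `aq₁ + bq₂` a sum of two hyperbolic planes
(i.e. equivalent over `F` to `Y₀Y₁ + Y₂Y₃`). -/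
theorem stmt_17 {F : Type*} [Field F] [Finite F] (hcard : 32 ≤ Nat.card F)
    (s₁ s₂ : MvPolynomial (Fin 4) F)
    (hs₁ : s₁.IsHomogeneous 2) (hs₂ : s₂.IsHomogeneous 2)
    (hs₁vars : ∀ i ∈ s₁.vars, 1 ≤ (i : ℕ)) (hs₂vars : ∀ i ∈ s₂.vars, 1 ≤ (i : ℕ))
    (q₁ q₂ : MvPolynomial (Fin 4) F)
    (hq₁ : q₁ = MvPolynomial.X 0 * MvPolynomial.X 1 + s₁)
    (hq₂ : q₂ = MvPolynomial.X 0 * MvPolynomial.X 2 + s₂)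
    (hnotboth : ¬ (MvPolynomial.eval (fun i : Fin 4 => if (i : ℕ) = 3 then (1 : F) else 0) s₁ = 0 ∧
      MvPolynomial.eval (fun i : Fin 4 => if (i : ℕ) = 3 then (1 : F) else 0) s₂ = 0)) :
    (∃ y : Fin 4 → F, y ≠ 0 ∧ MvPolynomial.eval y q₁ = 0 ∧ MvPolynomial.eval y q₂ = 0 ∧
      ∃ a b : F, (a ≠ 0 ∨ b ≠ 0) ∧
        ∀ j : Fin 4, a * MvPolynomial.eval y (MvPolynomial.pderiv j q₁) =
          b * MvPolynomial.eval y (MvPolynomial.pderiv j q₂)) ∨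
    5 * (Nat.card F - 1) ≤ Nat.card {p : F × F // p ≠ 0 ∧
      ∃ T : Matrix (Fin 4) (Fin 4) F, IsUnit T.det ∧
        substMat T (MvPolynomial.C p.1 * q₁ + MvPolynomial.C p.2 * q₂) =
          MvPolynomial.X 0 * MvPolynomial.X 1 + MvPolynomial.X 2 * MvPolynomial.X 3} := by
  have := Fintype.ofFinite F
  classical
  subst hq₁ hq₂
  obtain ⟨n, e₁, e₂, f₁, f₂, h⟩ := exists_presents hs₁ hs₂ hs₁vars hs₂vars hnotboth
  by_cases hd : n.cover.disc (Polynomial.X : Polynomial F) = 0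
  · obtain ⟨y₀, z₁, z₂, z₃, α, β, hz⟩ := NormalPair.exists_isSingularZero_of_disc_eq_zero hd
    exact .inl (h.exists_singular_zero hz)
  by_cases hm : n.cover.b₂ = 0 ∧ n.cover.a₃ = 0 ∧ n.cover.a₁ ^ 2 -
      n.cover.b₀ * n.cover.b₁ * n.cover.a₁ + n.cover.b₁ ^ 2 * n.cover.a₀ +
      n.cover.a₂ * n.cover.b₀ ^ 2 - 4 * n.cover.a₀ * n.cover.a₂ = 0
  · left
    obtain ⟨hb₂, ha₃, hΔ⟩ := hm
    by_cases h2 : (2 : F) ≠ 0 ∨ n.cover.b₀ ≠ 0 ∨ n.cover.b₁ ≠ 0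
    · obtain ⟨y₀, z₁, z₂, z₃, α, β, hz⟩ := NormalPair.exists_isSingularZero_of_conic hb₂ ha₃ hΔ h2
      exact h.exists_singular_zero hz
    · push Not at h2
      obtain ⟨y₀, z₁, z₂, z₃, α, β, hz⟩ :=
        NormalPair.exists_isSingularZero_of_two_eq_zero h2.1 h2.2.1 h2.2.2 hb₂
      exact h.exists_singular_zero hz
  · right
    rw [Nat.card_eq_fintype_card] at hcard
    refine (Nat.mul_le_mul_right _ (n.cover.five_le_card_isSplit hcard hd hm)).trans
      (h.card_mul_le_card _ fun t ht => (Finset.mem_filter.mp ht).2)
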